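/- Let U ≥ 1 be an integer, φ = 2π/(2U+1), χ > 0, and let j ∈ {−U, …, U}. Define s ∈ ℝ^{2U+1}, indexed by i ∈ {−U, …, U}, by s_i = χ·cos((j − i)φ). Then ‖Softmax(s) − e_j‖₁ ≤ 2(2U+1)·e^{−χ/U²}, where e_j is the standard basis vector with a 1 in coordinate j. -/

import Mathlib

/-- Softmax of a vector in ℝ^n: `softmax x i = exp (x i) / ∑ j, exp (x j)`. -/
noncomputable def softmax {n : ℕ} (x : Fin n → ℝ) : Fin n → ℝ :=
  fun i => Real.exp (x i) / ∑ j, Real.exp (x j)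

theorem softmax_nonneg {n : ℕ} (s : Fin n → ℝ) (i : Fin n) : 0 ≤ softmax s i := by
  unfold softmax
  positivity

theorem sum_softmax {n : ℕ} [NeZero n] (s : Fin n → ℝ) : ∑ i, softmax s i = 1 := by
  have h : 0 < ∑ i, Real.exp (s i) :=
    Finset.sum_pos (fun i _ => Real.exp_pos _) Finset.univ_nonempty
  simp only [softmax]
  rw [← Finset.sum_div, div_self h.ne']

theorem softmax_le_exp_sub {n : ℕ} (s : Fin n → ℝ) (i k : Fin n) :
    softmax s i ≤ Real.exp (s i - s k) := by
  rw [Real.exp_sub]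
  exact div_le_div_of_nonneg_left (Real.exp_pos _).le (Real.exp_pos _)
    (Finset.single_le_sum (f := fun i => Real.exp (s i))
      (fun i _ => (Real.exp_pos _).le) (Finset.mem_univ k))

/-- If the score at `k` exceeds all others by at least `δ`, the softmax weights are within
`2 n e^{-δ}` of the `k`-th basis vector in the `ℓ¹` norm. -/
theorem sum_abs_softmax_sub_single_le {n : ℕ} (s : Fin n → ℝ) (k : Fin n) (δ : ℝ)
    (hs : ∀ i, i ≠ k → s i ≤ s k - δ) :
    ∑ i, |softmax s i - if i = k then 1 else 0| ≤ 2 * n * Real.exp (-δ) := by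
  have : NeZero n := ⟨fun h => (h ▸ k).elim0⟩
  have hsum := sum_softmax s
  rw [← Finset.add_sum_erase _ _ (Finset.mem_univ k)] at hsum ⊢
  have hrest : ∑ i ∈ Finset.univ.erase k, |softmax s i - if i = k then 1 else 0| =
      ∑ i ∈ Finset.univ.erase k, softmax s i :=
    Finset.sum_congr rfl fun i hi => by
      rw [if_neg (Finset.ne_of_mem_erase hi), sub_zero, abs_of_nonneg (softmax_nonneg s i)]
  have hnonneg : 0 ≤ ∑ i ∈ Finset.univ.erase k, softmax s i :=
    Finset.sum_nonneg fun i _ => softmax_nonneg s i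
  have hle : ∑ i ∈ Finset.univ.erase k, softmax s i ≤ n * Real.exp (-δ) :=
    calc ∑ i ∈ Finset.univ.erase k, softmax s i
        ≤ ∑ _i ∈ Finset.univ.erase k, Real.exp (-δ) :=
          Finset.sum_le_sum fun i hi => (softmax_le_exp_sub s i k).trans
            (Real.exp_le_exp.2 (by linarith [hs i (Finset.ne_of_mem_erase hi)]))
      _ ≤ ∑ _i : Fin n, Real.exp (-δ) :=
          Finset.sum_le_sum_of_subset_of_nonneg (Finset.erase_subset _ _)
            fun _ _ _ => (Real.exp_pos _).le
      _ = n * Real.exp (-δ) := by simp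
  rw [hrest, if_pos rfl, abs_of_nonpos (by linarith)]
  linarith

theorem cos_two_pi_div_le (U : ℕ) (hU : 1 ≤ U) :
    Real.cos (2 * Real.pi / (2 * (U : ℝ) + 1)) ≤ 1 - 1 / (U : ℝ) ^ 2 := by
  obtain rfl | hU2 := hU.eq_or_lt
  · have h : 2 * Real.pi / (2 * ((1 : ℕ) : ℝ) + 1) = Real.pi - Real.pi / 3 := by
      push_cast
      ring
    rw [h, Real.cos_pi_sub, Real.cos_pi_div_three]
    norm_num
  · have hU' : (2 : ℝ) ≤ U := by exact_mod_cast hU2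
    have hpi := Real.pi_pos
    have hx : |2 * Real.pi / (2 * (U : ℝ) + 1)| ≤ Real.pi := by
      rw [abs_of_nonneg (by positivity), div_le_iff₀ (by positivity)]
      nlinarith
    have hcos := Real.cos_le_one_sub_mul_cos_sq hx
    have hval : 2 / Real.pi ^ 2 * (2 * Real.pi / (2 * (U : ℝ) + 1)) ^ 2 =
        8 / (2 * (U : ℝ) + 1) ^ 2 := by
      field_simp
      norm_num
    have hfrac : 1 / (U : ℝ) ^ 2 ≤ 8 / (2 * (U : ℝ) + 1) ^ 2 := by
      rw [div_le_div_iff₀ (by positivity) (by positivity)]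
      nlinarith
    linarith

theorem cos_nat_mul_le_cos (U m : ℕ) (hm : 1 ≤ m) (hmU : m ≤ 2 * U) :
    Real.cos (m * (2 * Real.pi / (2 * (U : ℝ) + 1))) ≤
      Real.cos (2 * Real.pi / (2 * (U : ℝ) + 1)) := by
  have hpi := Real.pi_pos
  have hle_half : ∀ r : ℕ, 1 ≤ r → r ≤ U →
      Real.cos (r * (2 * Real.pi / (2 * (U : ℝ) + 1))) ≤
        Real.cos (2 * Real.pi / (2 * (U : ℝ) + 1)) := by
    intro r hr hrU
    have hr' : (1 : ℝ) ≤ r := by exact_mod_cast hr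
    have hrU' : (r : ℝ) ≤ U := by exact_mod_cast hrU
    refine Real.cos_le_cos_of_nonneg_of_le_pi (by positivity) ?_
      (le_mul_of_one_le_left (by positivity) hr')
    rw [mul_div_assoc', div_le_iff₀ (by positivity)]
    nlinarith
  obtain h | h := le_or_gt m U
  · exact hle_half m hm h
  · have hreflect : (m : ℝ) * (2 * Real.pi / (2 * (U : ℝ) + 1)) =
        2 * Real.pi - ((2 * U + 1 - m : ℕ) : ℝ) * (2 * Real.pi / (2 * (U : ℝ) + 1)) := by
      rw [Nat.cast_sub (by omega)]
      push_cast
      field_simp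
      ring
    rw [hreflect, Real.cos_two_pi_sub]
    exact hle_half _ (by omega) (by omega)

theorem cos_int_mul_le (U : ℕ) (hU : 1 ≤ U) (d : ℤ) (hd : d ≠ 0) (hdU : |d| ≤ 2 * U) :
    Real.cos (d * (2 * Real.pi / (2 * (U : ℝ) + 1))) ≤ 1 - 1 / (U : ℝ) ^ 2 := by
  have habs : Real.cos (d * (2 * Real.pi / (2 * (U : ℝ) + 1))) =
      Real.cos (d.natAbs * (2 * Real.pi / (2 * (U : ℝ) + 1))) := by
    rw [← Real.cos_abs, abs_mul, Nat.cast_natAbs, Int.cast_abs,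
      abs_of_nonneg (a := 2 * Real.pi / (2 * (U : ℝ) + 1)) (by positivity)]
  rw [habs]
  rw [Int.abs_eq_natAbs] at hdU
  exact (cos_nat_mul_le_cos U _ (by omega) (by omega)).trans (cos_two_pi_div_le U hU)

/-- Attention by relative position via sinusoidal encodings: for `U ≥ 1`,
`φ = 2π/(2U+1)`, `χ > 0` and `j ∈ {−U,…,U}`, the score vector `s` indexed by
`i ∈ {−U,…,U}` (here the index `i : Fin (2U+1)` encodes the position `i − U ∈ {−U,…,U}`)
with `s_i = χ · cos((j − i)φ)` satisfies `‖Softmax(s) − e_j‖₁ ≤ 2(2U+1) e^{−χ/U²}`. -/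
theorem softmax_relative_position (U : ℕ) (hU : 1 ≤ U) (χ : ℝ) (hχ : 0 < χ)
    (j : ℤ) (hj₁ : -(U : ℤ) ≤ j) (hj₂ : j ≤ (U : ℤ)) (φ : ℝ)
    (hφ : φ = 2 * Real.pi / (2 * (U : ℝ) + 1)) :
    ∑ i : Fin (2 * U + 1),
        |softmax (fun i' : Fin (2 * U + 1) =>
            χ * Real.cos (((j - (((i' : ℕ) : ℤ) - (U : ℤ)) : ℤ) : ℝ) * φ)) i -
          (if ((i : ℕ) : ℤ) - (U : ℤ) = j then (1 : ℝ) else 0)| ≤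
      2 * (2 * (U : ℝ) + 1) * Real.exp (-(χ / (U : ℝ) ^ 2)) := by
  subst hφ
  obtain ⟨k, hk⟩ : ∃ k : Fin (2 * U + 1), ((k : ℕ) : ℤ) - (U : ℤ) = j :=
    ⟨⟨(j + U).toNat, by omega⟩, by simp only; omega⟩
  have hiff : ∀ i : Fin (2 * U + 1), ((i : ℕ) : ℤ) - (U : ℤ) = j ↔ i = k := fun i => by
    rw [Fin.ext_iff]
    omega
  simp only [hiff]
  have hbound := sum_abs_softmax_sub_single_le (fun i' : Fin (2 * U + 1) =>
    χ * Real.cos (((j - (((i' : ℕ) : ℤ) - (U : ℤ)) : ℤ) : ℝ) *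
      (2 * Real.pi / (2 * (U : ℝ) + 1)))) k (χ / (U : ℝ) ^ 2) fun i hi => by
    have hne := mt (hiff i).1 hi
    have hcos := cos_int_mul_le U hU (j - ((i : ℕ) - U)) (by omega)
      (abs_le.2 ⟨by omega, by omega⟩)
    have hgap := mul_le_mul_of_nonneg_left hcos hχ.le
    rw [mul_sub, mul_one_div] at hgap
    simpa only [hk, sub_self, Int.cast_zero, zero_mul, Real.cos_zero] using hgap
  push_cast at hbound ⊢
  exact hbound
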